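/- Let Σ be an n×n nonnegative matrix measure on ℝ, let ρ be a finite Borel measure equivalent to Σ (ρ(δ) = 0 ↔ Σ(δ) = 0 for all Borel δ), and let Ψ : ℝ → Matrix (Fin n) (Fin n) ℂ be a Borel measurable density (Σ(δ) = ∫_δ Ψ dρ) with Ψ(t) positive semidefinite for all t. Let m ≥ 1 be the total multiplicity of Σ: assume ρ{ t : rank Ψ(t) > m } = 0 and ρ{ t : rank Ψ(t) ≥ m } > 0. Let h ∈ ℂⁿ be a vector of maximal type for Σ (for every Borel δ, ⟪Σ(δ)h,h⟫ = 0 implies Σ(δ) = 0). Then there exist orthonormal vectors e₁, …, e_m ∈ ℂⁿ with e₁ = h/‖h‖ such that for every k with 1 ≤ k ≤ m, the set { t ∈ ℝ : det ( (⟪Ψ(t) e_j, e_i⟫)_{1 ≤ i,j ≤ k} ) ≠ 0 } coincides with { t ∈ ℝ : rank Ψ(t) ≥ k } up to a ρ-null set. -/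

import Mathlib

open MeasureTheory Matrix
open scoped ComplexOrder ComplexInnerProductSpace

theorem Matrix.PosSemidef.det_compression_ne_zero_iff {n ι : Type*} [Fintype n] [Fintype ι]
    [DecidableEq ι] {A : Matrix n n ℂ} (hA : A.PosSemidef) (v : ι → n → ℂ) :
    (Matrix.of fun i j => star (v i) ⬝ᵥ A *ᵥ v j).det ≠ 0 ↔
      LinearIndependent ℂ fun i => A *ᵥ v i := by
  have key (x : ι → ℂ) : (Matrix.of fun i j => star (v i) ⬝ᵥ A *ᵥ v j) *ᵥ x
      = fun i => star (v i) ⬝ᵥ A *ᵥ ∑ j, x j • v j := by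
    ext i
    simp only [mulVec_sum, mulVec_smul, dotProduct_sum, dotProduct_smul]
    simp [mulVec, dotProduct, mul_comm]
  rw [Fintype.linearIndependent_iff, Ne, ← exists_mulVec_eq_zero_iff]
  simp only [← mulVec_smul, ← mulVec_sum, key]
  constructor
  · intro h x hx
    by_contra! hne
    exact h ⟨x, fun h0 => by simp [h0] at hne, by simp [hx]; rfl⟩
  · rintro h ⟨x, hx0, hx⟩
    refine hx0 (funext (h x ?_))
    rw [← hA.dotProduct_mulVec_zero_iff, star_sum, sum_dotProduct]
    refine Finset.sum_eq_zero fun i _ => ?_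
    simpa using Or.inr (congrFun hx i)

theorem measurableSet_linearIndependent {α n ι : Type*} [MeasurableSpace α] [Fintype n]
    [Fintype ι] {f : ι → α → n → ℂ} (hf : ∀ i j, Measurable fun x => f i x j) :
    MeasurableSet {x | LinearIndependent ℂ fun i => f i x} := by
  classical
  have h (x : α) : LinearIndependent ℂ (fun i => f i x) ↔
      (Matrix.of fun i j => star (f i x) ⬝ᵥ (1 : Matrix n n ℂ) *ᵥ f j x).det ≠ 0 := by
    rw [PosSemidef.one.det_compression_ne_zero_iff]
    simp
  simp only [h]
  refine (measurableSet_eq_fun (f := fun x =>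
    (Matrix.of fun i j => star (f i x) ⬝ᵥ (1 : Matrix n n ℂ) *ᵥ f j x).det)
    (g := fun _ => 0) ?_ measurable_const).compl
  simp only [det_apply', one_mulVec, of_apply, dotProduct, Pi.star_apply, RCLike.star_def]
  have := Complex.continuous_conj.measurable
  refine Finset.measurable_sum _ fun σ _ => Measurable.const_mul (Finset.measurable_prod _ fun i _ =>
    Finset.measurable_sum _ fun j _ => Measurable.mul ?_ (hf _ _)) _
  exact this.comp (hf _ _)

theorem ae_linearIndependent_mulVec_succ {n k : ℕ} (A : Matrix (Fin n) (Fin n) ℂ)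
    (v : ℕ → Fin n → ℂ) (hk : k < A.rank)
    (hv : LinearIndependent ℂ fun i : Fin k => A *ᵥ v i) :
    ∀ᵐ w : Fin n → ℂ,
      LinearIndependent ℂ fun i : Fin (k + 1) => A *ᵥ Function.update v k w i := by
  let W : Submodule ℂ (Fin n → ℂ) :=
    (Submodule.span ℂ (Set.range fun i : Fin k => A *ᵥ v i)).comap A.mulVecLin
  have hW : W ≠ ⊤ := by
    intro hW
    have hle : LinearMap.range A.mulVecLin ≤
        Submodule.span ℂ (Set.range fun i : Fin k => A *ᵥ v i) := by
      rintro _ ⟨x, rfl⟩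
      exact (hW ▸ Submodule.mem_top : x ∈ W)
    have := Submodule.finrank_mono hle
    rw [finrank_span_eq_card hv, Fintype.card_fin] at this
    exact absurd hk (not_lt.2 this)
  have h0 : volume ((W.restrictScalars ℝ : Submodule ℝ (Fin n → ℂ)) : Set (Fin n → ℂ)) = 0 :=
    Measure.addHaar_submodule _ _ (by simpa using hW)
  filter_upwards [measure_eq_zero_iff_ae_notMem.1 h0] with w hw
  have hinit : (Fin.init fun i : Fin (k + 1) => A *ᵥ Function.update v k w i) =
      fun i : Fin k => A *ᵥ v i := by
    ext1 i
    simp [Fin.init, Function.update_of_ne i.2.ne]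
  rw [linearIndependent_finSucc', hinit]
  refine ⟨hv, ?_⟩
  simpa [W] using hw

theorem exists_ae_linearIndependent_mulVec_succ {α : Type*} [MeasurableSpace α] (μ : Measure α)
    [SFinite μ] {n : ℕ} {Ψ : α → Matrix (Fin n) (Fin n) ℂ}
    (hΨ : ∀ i j, Measurable fun t => Ψ t i j) (v : ℕ → Fin n → ℂ) (k : ℕ) :
    ∃ w : Fin n → ℂ, ∀ᵐ t ∂μ, k < (Ψ t).rank →
      LinearIndependent ℂ (fun i : Fin k => Ψ t *ᵥ v i) →
      LinearIndependent ℂ fun i : Fin (k + 1) => Ψ t *ᵥ Function.update v k w i := by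
  let G : Set (α × (Fin n → ℂ)) :=
    {p | LinearIndependent ℂ fun i : Fin (k + 1) => Ψ p.1 *ᵥ Function.update v k p.2 i}
  have hG : MeasurableSet G := by
    refine measurableSet_linearIndependent fun i j => ?_
    simp only [mulVec, dotProduct]
    refine Finset.measurable_sum _ fun l _ =>
      ((hΨ j l).comp measurable_fst).mul ?_
    rcases eq_or_ne (i : ℕ) k with h | h
    · simpa [h] using (by fun_prop : Measurable fun p : α × (Fin n → ℂ) => p.2 l)
    · simp [h]
  let T : Set α := {t | volume (Prod.mk t ⁻¹' Gᶜ) = 0}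
  have hT : MeasurableSet T :=
    measurable_measure_prodMk_left hG.compl (measurableSet_singleton 0)
  have hae : ∀ᵐ t ∂μ, ∀ᵐ w : Fin n → ℂ, t ∈ T → (t, w) ∈ G := by
    refine .of_forall fun t => ?_
    by_cases ht : t ∈ T
    · filter_upwards [measure_eq_zero_iff_ae_notMem.1 ht] with w hw _
      simpa using hw
    · simp [ht]
  rw [Measure.ae_ae_comm ((measurable_fst hT).imp hG)] at hae
  obtain ⟨w, hw⟩ := hae.exists
  refine ⟨w, hw.mono fun t ht hk hv => ht ?_⟩
  exact measure_eq_zero_iff_ae_notMem.2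
    ((ae_linearIndependent_mulVec_succ _ v hk hv).mono fun w hw => by simpa [G] using hw)

theorem exists_ae_linearIndependent_mulVec {α : Type*} [MeasurableSpace α] (μ : Measure α)
    [SFinite μ] {n : ℕ} {Ψ : α → Matrix (Fin n) (Fin n) ℂ}
    (hΨ : ∀ i j, Measurable fun t => Ψ t i j) (h : Fin n → ℂ) (hh : ∀ᵐ t ∂μ, Ψ t *ᵥ h ≠ 0)
    (m : ℕ) :
    ∃ v : ℕ → Fin n → ℂ, v 0 = h ∧ ∀ᵐ t ∂μ, ∀ k ≤ m + 1, k ≤ (Ψ t).rank →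
      LinearIndependent ℂ fun i : Fin k => Ψ t *ᵥ v i := by
  induction m with
  | zero =>
    refine ⟨fun _ => h, rfl, hh.mono fun t ht k hk _ => ?_⟩
    interval_cases k
    · exact linearIndependent_empty_type
    · exact linearIndependent_unique_iff.2 ht
  | succ m ih =>
    obtain ⟨v, hv0, hv⟩ := ih
    obtain ⟨w, hw⟩ := exists_ae_linearIndependent_mulVec_succ μ hΨ v (m + 1)
    refine ⟨Function.update v (m + 1) w, by simp [hv0], ?_⟩
    filter_upwards [hv, hw] with t hvt hwt k hk hr
    rcases hk.lt_or_eq with hk' | rfl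
    · convert hvt k (by omega) hr using 3 with i
      rw [Function.update_of_ne (by omega)]
    · exact hwt hr (hvt _ le_rfl (by omega))

theorem linearIndependent_map_iff_of_span_eq {ι K V W : Type*} [Fintype ι] [DivisionRing K]
    [AddCommGroup V] [Module K V] [AddCommGroup W] [Module K W] (L : V →ₗ[K] W) {v w : ι → V}
    (h : Submodule.span K (Set.range v) = Submodule.span K (Set.range w)) :
    (LinearIndependent K fun i => L (v i)) ↔ LinearIndependent K fun i => L (w i) := by
  have key (u : ι → V) : Submodule.span K (Set.range fun i => L (u i)) =
      (Submodule.span K (Set.range u)).map L := by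
    rw [Submodule.map_span, ← Set.range_comp]
    rfl
  rw [linearIndependent_iff_card_eq_finrank_span, linearIndependent_iff_card_eq_finrank_span,
    Set.finrank, Set.finrank, key, key, h]

theorem span_range_castLE_gramSchmidtNormed {E : Type*} [NormedAddCommGroup E]
    [InnerProductSpace ℂ E] {m k : ℕ} (hk : k ≤ m) (f : Fin m → E) :
    Submodule.span ℂ (Set.range fun i : Fin k =>
        InnerProductSpace.gramSchmidtNormed ℂ f (Fin.castLE hk i)) =
      Submodule.span ℂ (Set.range fun i : Fin k => f (Fin.castLE hk i)) := by
  cases k with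
  | zero => simp
  | succ k =>
    have key (g : Fin m → E) : (Set.range fun i : Fin (k + 1) => g (Fin.castLE hk i)) =
        g '' Set.Iic ⟨k, hk⟩ := by
      ext x
      constructor
      · rintro ⟨i, rfl⟩
        exact ⟨_, Fin.le_def.2 (Nat.lt_succ_iff.1 i.2), rfl⟩
      · rintro ⟨i, hi, rfl⟩
        exact ⟨⟨i, Nat.lt_succ_iff.2 hi⟩, rfl⟩
    rw [key, key, InnerProductSpace.span_gramSchmidtNormed, InnerProductSpace.span_gramSchmidt_Iic]

theorem ae_dotProduct_mulVec_ne_zero_of_maximal {α : Type*} [MeasurableSpace α] {n : ℕ}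
    {S : VectorMeasure α (Matrix (Fin n) (Fin n) ℂ)} {ρ : Measure α} [IsFiniteMeasure ρ]
    (hequiv : ∀ δ, MeasurableSet δ → (ρ δ = 0 ↔ S δ = 0))
    {Ψ : α → Matrix (Fin n) (Fin n) ℂ}
    (hΨmeas : ∀ i j, Measurable fun t => Ψ t i j)
    (hdens : ∀ δ, MeasurableSet δ → ∀ i j, S δ i j = ∫ t in δ, Ψ t i j ∂ρ)
    {h : Fin n → ℂ}
    (hmax : ∀ δ, MeasurableSet δ → star h ⬝ᵥ S δ *ᵥ h = 0 → S δ = 0) :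
    ∀ᵐ t ∂ρ, star h ⬝ᵥ Ψ t *ᵥ h ≠ 0 := by
  let B (N : ℕ) : Set α := {t | ∀ i j, ‖Ψ t i j‖ ≤ N}
  have hB N : MeasurableSet (B N) := by
    simp only [B, Set.ofPred_forall]
    exact .iInter fun i => .iInter fun j => measurableSet_le (hΨmeas i j).norm measurable_const
  let Z : Set α := {t | star h ⬝ᵥ Ψ t *ᵥ h = 0}
  have hZ : MeasurableSet Z := by
    refine measurableSet_eq_fun ?_ measurable_const
    simp only [mulVec, dotProduct]
    exact Finset.measurable_sum _ fun i _ => measurable_const.mul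
      (Finset.measurable_sum _ fun j _ => (hΨmeas i j).mul measurable_const)
  have hnull N : ρ (Z ∩ B N) = 0 := by
    have hδ := hZ.inter (hB N)
    refine (hequiv _ hδ).2 (hmax _ hδ ?_)
    have hint i j : Integrable (fun t => Ψ t i j) (ρ.restrict (Z ∩ B N)) := by
      refine .of_bound (hΨmeas i j).aestronglyMeasurable N ?_
      filter_upwards [ae_restrict_mem hδ] with t ht using ht.2 i j
    calc star h ⬝ᵥ S (Z ∩ B N) *ᵥ h
        = ∫ t in Z ∩ B N, star h ⬝ᵥ Ψ t *ᵥ h ∂ρ := by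
          simp only [mulVec, dotProduct, hdens _ hδ]
          rw [integral_finsetSum _ fun i _ =>
            (integrable_finsetSum _ fun j _ => (hint i j).mul_const _).const_mul _]
          simp only [integral_const_mul]
          refine Finset.sum_congr rfl fun i _ => ?_
          rw [integral_finsetSum _ fun j _ => (hint i j).mul_const _]
          simp only [integral_mul_const]
      _ = 0 := setIntegral_eq_zero_of_forall_eq_zero fun t ht => ht.1
  refine measure_mono_null (fun t ht => ?_) (measure_iUnion_null hnull)
  obtain ⟨N, hN⟩ := exists_nat_ge (∑ i, ∑ j, ‖Ψ t i j‖)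
  refine Set.mem_iUnion.2 ⟨N, by simpa [Z] using ht, fun i j => le_trans ?_ hN⟩
  exact (Finset.single_le_sum (f := fun j => ‖Ψ t i j‖) (fun _ _ => norm_nonneg _)
    (Finset.mem_univ j)).trans (Finset.single_le_sum (f := fun i => ∑ j, ‖Ψ t i j‖)
      (fun _ _ => Finset.sum_nonneg fun _ _ => norm_nonneg _) (Finset.mem_univ i))

theorem LinearIndependent.le_rank_of_mulVec {n k : ℕ} {A : Matrix (Fin n) (Fin n) ℂ}
    {v : Fin k → Fin n → ℂ} (hv : LinearIndependent ℂ fun i => A *ᵥ v i) : k ≤ A.rank := by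
  have hle : Submodule.span ℂ (Set.range fun i => A *ᵥ v i) ≤ LinearMap.range A.mulVecLin :=
    Submodule.span_le.2 (by rintro _ ⟨i, rfl⟩; exact ⟨v i, rfl⟩)
  simpa [finrank_span_eq_card hv, Matrix.rank] using Submodule.finrank_mono hle

theorem inner_toEuclideanLin_eq {n : ℕ} {A : Matrix (Fin n) (Fin n) ℂ} (hA : A.IsHermitian)
    (x y : EuclideanSpace ℂ (Fin n)) :
    ⟪Matrix.toEuclideanLin A x, y⟫ = star x.ofLp ⬝ᵥ A *ᵥ y.ofLp := by
  rw [EuclideanSpace.inner_eq_star_dotProduct, Matrix.ofLp_toLpLin, toLin'_apply, star_mulVec,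
    hA.eq, dotProduct_comm, dotProduct_mulVec]

/-- **Theorem 4 (existence of a Hellinger chain), finite-dimensional case, combined
with the determinant criterion (4).**
Let `S` be an `n × n` nonnegative matrix measure on `ℝ`, `ρ ∼ S` a finite Borel
measure, `Ψ` a Borel measurable positive semidefinite density `dS/dρ`, and let
`m ≥ 1` be the total multiplicity of `S` (`rank Ψ(t) ≤ m` a.e. and
`rank Ψ(t) ≥ m` on a set of positive measure).  If `h` is a vector of maximal type
for `S`, then there are orthonormal vectors `e₁, …, e_m` with `e₁ = h / ‖h‖` such
that for every `1 ≤ k ≤ m` the set where the compressed `k × k` density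
`(⟪Ψ(t) eⱼ, eᵢ⟫)_{i,j ≤ k}` has nonzero determinant coincides, up to a `ρ`-null
set, with `Γ_k(S) = {t : rank Ψ(t) ≥ k}`. -/
theorem stmt_7 (n m : ℕ) (hm : 1 ≤ m)
    (S : VectorMeasure ℝ (Matrix (Fin n) (Fin n) ℂ))
    (hpos : ∀ δ : Set ℝ, MeasurableSet δ → (S δ).PosSemidef)
    (ρ : Measure ℝ) [IsFiniteMeasure ρ]
    (hequiv : ∀ δ : Set ℝ, MeasurableSet δ → (ρ δ = 0 ↔ S δ = 0))
    (Ψ : ℝ → Matrix (Fin n) (Fin n) ℂ)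
    (hΨmeas : ∀ i j, Measurable fun t => Ψ t i j)
    (hΨpos : ∀ t, (Ψ t).PosSemidef)
    (hdens : ∀ δ : Set ℝ, MeasurableSet δ → ∀ i j, S δ i j = ∫ t in δ, Ψ t i j ∂ρ)
    (hm₁ : ρ {t | m < (Ψ t).rank} = 0)
    (hm₂ : 0 < ρ {t | m ≤ (Ψ t).rank})
    (h : EuclideanSpace ℂ (Fin n))
    (hmax : ∀ δ : Set ℝ, MeasurableSet δ →
      ⟪Matrix.toEuclideanLin (S δ) h, h⟫ = 0 → S δ = 0) :
    ∃ e : Fin m → EuclideanSpace ℂ (Fin n), Orthonormal ℂ e ∧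
      e ⟨0, hm⟩ = ‖h‖⁻¹ • h ∧
      ∀ (k : ℕ) (hk : k ≤ m), 1 ≤ k →
        {t : ℝ | (Matrix.of fun i j : Fin k =>
            ⟪Matrix.toEuclideanLin (Ψ t) (e (Fin.castLE hk j)),
              e (Fin.castLE hk i)⟫).det ≠ 0}
          =ᵐ[ρ] {t : ℝ | k ≤ (Ψ t).rank} := by
  have hψ : ∀ᵐ t ∂ρ, Ψ t *ᵥ h.ofLp ≠ 0 := by
    refine (ae_dotProduct_mulVec_ne_zero_of_maximal hequiv hΨmeas hdens
      (h := h.ofLp) fun δ hδ h0 => hmax δ hδ ?_).mono fun t ht h0 => ht (by simp [h0])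
    rw [inner_toEuclideanLin_eq (hpos δ hδ).isHermitian, h0]
  obtain ⟨v, hv0, hv⟩ := exists_ae_linearIndependent_mulVec ρ hΨmeas _ hψ m
  let f (i : Fin m) : EuclideanSpace ℂ (Fin n) := WithLp.toLp 2 (v i)
  have hf : LinearIndependent ℂ f := by
    obtain ⟨t, ht, hvt⟩ := ((frequently_ae_iff.2 hm₂.ne').and_eventually hv).exists
    exact LinearIndependent.of_comp
      ((Ψ t).mulVecLin ∘ₗ (WithLp.linearEquiv 2 ℂ (Fin n → ℂ)).toLinearMap)
      (hvt m (Nat.le_succ m) ht)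
  refine ⟨InnerProductSpace.gramSchmidtNormed ℂ f,
    InnerProductSpace.gramSchmidtNormed_orthonormal hf, ?_, fun k hk _ => ?_⟩
  · have hbot : Finset.Iio (⟨0, hm⟩ : Fin m) = ∅ := by
      ext i
      simp [Fin.lt_def]
    have hf0 : f ⟨0, hm⟩ = h := by simp [f, hv0]
    rw [InnerProductSpace.gramSchmidtNormed, InnerProductSpace.gramSchmidt_def, hbot,
      Finset.sum_empty, sub_zero, hf0]
    ext i
    simp
  · filter_upwards [hv] with t hvt
    refine propext ?_
    have hdet : (Matrix.of fun i j : Fin k =>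
        ⟪Matrix.toEuclideanLin (Ψ t) (InnerProductSpace.gramSchmidtNormed ℂ f (Fin.castLE hk j)),
          InnerProductSpace.gramSchmidtNormed ℂ f (Fin.castLE hk i)⟫).det ≠ 0 ↔
        LinearIndependent ℂ fun i : Fin k => Ψ t *ᵥ v i := by
      rw [← det_transpose]
      simp only [inner_toEuclideanLin_eq (hΨpos t).isHermitian]
      exact ((hΨpos t).det_compression_ne_zero_iff _).trans <|
        linearIndependent_map_iff_of_span_eq
          ((Ψ t).mulVecLin ∘ₗ (WithLp.linearEquiv 2 ℂ (Fin n → ℂ)).toLinearMap)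
          (span_range_castLE_gramSchmidtNormed hk f)
    exact hdet.trans ⟨fun hli => hli.le_rank_of_mulVec, hvt k (by omega)⟩
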